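/- The point (w_1, w_2, z_1, z_2, z_3) = (2/3, 7/3, 2/3, 0, 1/3) is an extreme point of the polyhedron P = {(w_1, w_2, z_1, z_2, z_3) ∈ ℝ^5 : 2(z_1 + z_2) + 3 z_3 ≥ w_1, 2 z_1 + 3(z_2 + z_3) ≥ w_2, 2 z_3 ≤ w_1, 2 z_2 ≤ w_2, z_1 + z_2 + z_3 = 1, w_1 + w_2 ≤ 3, 0 ≤ w_1 ≤ 3, 0 ≤ w_2 ≤ 3, z_1, z_2, z_3 ≥ 0}. In particular P has a fractional extreme point, so adding the linear constraint w_1 + w_2 ≤ 3 to the union-of-polyhedra formulation of a single tree yields a formulation that is not ideal. -/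

import Mathlib

/-- If a proper convex combination of two nonnegative reals vanishes, then both vanish. -/
theorem eq_zero_of_convex_combination_eq_zero {t u v : ℝ} (ht₀ : 0 < t) (ht₁ : t < 1)
    (hu : 0 ≤ u) (hv : 0 ≤ v) (h : t * u + (1 - t) * v = 0) : u = 0 ∧ v = 0 := by
  have ht : 0 < 1 - t := sub_pos.2 ht₁
  obtain ⟨h₁, h₂⟩ := (add_eq_zero_iff_of_nonneg (by positivity) (by positivity)).1 h
  exact ⟨(mul_eq_zero_iff_left ht₀.ne').1 h₁, (mul_eq_zero_iff_left ht.ne').1 h₂⟩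

/-- the fractional point `(w₁, w₂, z₁, z₂, z₃) = (2/3, 7/3, 2/3, 0, 1/3)` is an
extreme point of the union-of-polyhedra formulation of a three-leaf tree intersected with the
additional constraint `w₁ + w₂ ≤ 3`; in particular adding this linear constraint yields a
formulation that is not ideal. Coordinates: `q = (w₁, w₂, z₁, z₂, z₃)`. -/
theorem constrained_tree_not_ideal (P : Set (ℝ × ℝ × ℝ × ℝ × ℝ))
    (hP : P = {q | 2 * (q.2.2.1 + q.2.2.2.1) + 3 * q.2.2.2.2 ≥ q.1 ∧
        2 * q.2.2.1 + 3 * (q.2.2.2.1 + q.2.2.2.2) ≥ q.2.1 ∧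
        2 * q.2.2.2.2 ≤ q.1 ∧
        2 * q.2.2.2.1 ≤ q.2.1 ∧
        q.2.2.1 + q.2.2.2.1 + q.2.2.2.2 = 1 ∧
        q.1 + q.2.1 ≤ 3 ∧
        0 ≤ q.1 ∧ q.1 ≤ 3 ∧ 0 ≤ q.2.1 ∧ q.2.1 ≤ 3 ∧
        0 ≤ q.2.2.1 ∧ 0 ≤ q.2.2.2.1 ∧ 0 ≤ q.2.2.2.2}) :
    ((2/3, 7/3, 2/3, 0, 1/3) : ℝ × ℝ × ℝ × ℝ × ℝ) ∈ P ∧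
    ∀ a ∈ P, ∀ b ∈ P, ∀ t : ℝ, 0 < t → t < 1 →
      ((2/3, 7/3, 2/3, 0, 1/3) : ℝ × ℝ × ℝ × ℝ × ℝ) = t • a + (1 - t) • b →
      a = ((2/3, 7/3, 2/3, 0, 1/3) : ℝ × ℝ × ℝ × ℝ × ℝ) ∧
      b = ((2/3, 7/3, 2/3, 0, 1/3) : ℝ × ℝ × ℝ × ℝ × ℝ) := by
  subst hP
  refine ⟨by norm_num, ?_⟩
  rintro ⟨a₁, a₂, a₃, a₄, a₅⟩ ⟨-, ha_upper, ha_lower, -, ha_sum, ha_budget, -, -, -, -, -, ha₄, -⟩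
    ⟨b₁, b₂, b₃, b₄, b₅⟩ ⟨-, hb_upper, hb_lower, -, hb_sum, hb_budget, -, -, -, -, -, hb₄, -⟩
    t ht₀ ht₁ h
  simp only [Prod.smul_mk, Prod.mk_add_mk, smul_eq_mul, Prod.mk.injEq] at *
  obtain ⟨h₁, h₂, h₃, h₄, h₅⟩ := h
  -- The four inequalities tight at the point are tight at both `a` and `b`.
  have upper := eq_zero_of_convex_combination_eq_zero ht₀ ht₁
    (sub_nonneg.2 ha_upper) (sub_nonneg.2 hb_upper)
    (by linear_combination h₂ - 2 * h₃ - 3 * h₄ - 3 * h₅)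
  have lower := eq_zero_of_convex_combination_eq_zero ht₀ ht₁
    (sub_nonneg.2 ha_lower) (sub_nonneg.2 hb_lower) (by linear_combination 2 * h₅ - h₁)
  have budget := eq_zero_of_convex_combination_eq_zero ht₀ ht₁
    (sub_nonneg.2 ha_budget) (sub_nonneg.2 hb_budget) (by linear_combination h₁ + h₂)
  have leaf := eq_zero_of_convex_combination_eq_zero ht₀ ht₁ ha₄ hb₄ h₄.symm
  refine ⟨⟨?_, ?_, ?_, ?_, ?_⟩, ?_, ?_, ?_, ?_, ?_⟩ <;> linarith
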